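/- Every biharmonic function on ℝⁿ with polynomial growth of rate d ≥ 0 is a polynomial of degree at most d. -/

import Mathlib

open MeasureTheory

noncomputable def lap {n : ℕ} (u : EuclideanSpace ℝ (Fin n) → ℝ)
    (x : EuclideanSpace ℝ (Fin n)) : ℝ :=
  ∑ i : Fin n, fderiv ℝ (fun y => fderiv ℝ u y (EuclideanSpace.single i 1)) x
    (EuclideanSpace.single i 1)

open scoped ContDiff

/-- The directional derivative of `u` along the `i`-th coordinate. -/
noncomputable def partialDeriv {n : ℕ} (i : Fin n) (u : EuclideanSpace ℝ (Fin n) → ℝ) :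
    EuclideanSpace ℝ (Fin n) → ℝ :=
  fun x => fderiv ℝ u x (EuclideanSpace.single i 1)

section PartialDeriv

variable {n : ℕ} {u : EuclideanSpace ℝ (Fin n) → ℝ}

lemma ContDiff.partialDeriv (hu : ContDiff ℝ ∞ u) (i : Fin n) :
    ContDiff ℝ ∞ (partialDeriv i u) :=
  (hu.fderiv_right (by simp)).clm_apply contDiff_const

lemma lap_eq_sum_partialDeriv :
    lap u = fun x => ∑ i, partialDeriv i (partialDeriv i u) x := rfl

lemma ContDiff.lap (hu : ContDiff ℝ ∞ u) : ContDiff ℝ ∞ (lap u) := by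
  rw [lap_eq_sum_partialDeriv]
  exact ContDiff.sum fun i _ => (hu.partialDeriv i).partialDeriv i

lemma fderiv_apply_eq_sum_partialDeriv (x y : EuclideanSpace ℝ (Fin n)) :
    fderiv ℝ u x y = ∑ i, y i * partialDeriv i u x := by
  have hy : y = ∑ i, y i • EuclideanSpace.single i (1 : ℝ) := by
    simpa using ((EuclideanSpace.basisFun (Fin n) ℝ).sum_repr y).symm
  conv_lhs => rw [hy]
  simp [partialDeriv]

lemma partialDeriv_comm (hu : ContDiff ℝ ∞ u) (i j : Fin n) :
    partialDeriv i (partialDeriv j u) = partialDeriv j (partialDeriv i u) := by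
  have hd : Differentiable ℝ (fderiv ℝ u) :=
    (hu.fderiv_right (m := ∞) (by simp)).differentiable (by simp)
  have key (v w x : EuclideanSpace ℝ (Fin n)) :
      fderiv ℝ (fun y => fderiv ℝ u y v) x w = fderiv ℝ (fderiv ℝ u) x w v := by
    rw [fderiv_clm_apply (hd x) (differentiableAt_const v)]
    simp
  ext x
  have hs : IsSymmSndFDerivAt ℝ u x := 
    (contDiff_infty.1 hu 2).contDiffAt.isSymmSndFDerivAt (by simp)
  unfold partialDeriv
  rw [key, key]
  exact hs _ _

lemma lap_partialDeriv (hu : ContDiff ℝ ∞ u) (i : Fin n) :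
    lap (partialDeriv i u) = partialDeriv i (lap u) := by
  ext x
  have h : fderiv ℝ (lap u) x = ∑ j, fderiv ℝ (partialDeriv j (partialDeriv j u)) x := by
    rw [lap_eq_sum_partialDeriv]
    exact fderiv_fun_sum fun j _ =>
      ((hu.partialDeriv j).partialDeriv j).differentiable (by simp) x
  rw [partialDeriv, h, lap_eq_sum_partialDeriv]
  simp only [sum_apply]
  refine Finset.sum_congr rfl fun j _ => ?_
  rw [partialDeriv_comm hu j i, partialDeriv_comm (hu.partialDeriv j) j i]
  rfl

lemma lap_lap_partialDeriv (hu : ContDiff ℝ ∞ u) (h : ∀ x, lap (lap u) x = 0) (i : Fin n)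
    (x : EuclideanSpace ℝ (Fin n)) : lap (lap (partialDeriv i u)) x = 0 := by
  have h' : lap (lap u) = fun _ => 0 := funext h
  rw [lap_partialDeriv hu, lap_partialDeriv hu.lap, h', partialDeriv]
  simp

end PartialDeriv

lemma hasDerivAt_max_zero_pow (k : ℕ) (s : ℝ) :
    HasDerivAt (fun s : ℝ => max 0 s ^ (k + 2)) ((k + 2) * max 0 s ^ (k + 1)) s := by
  refine hasDerivAt_of_hasDerivAt_of_ne' (x := 0)
    (g := fun s : ℝ => (k + 2) * max 0 s ^ (k + 1)) (fun y hy => ?_) ?_ ?_ s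
  · rcases hy.lt_or_gt with hy | hy
    · have : (fun s : ℝ => max 0 s ^ (k + 2)) =ᶠ[nhds y] fun _ => 0 := by
        filter_upwards [Iio_mem_nhds hy] with z hz
        simp [max_eq_left (Set.mem_Iio.1 hz).le]
      simpa [max_eq_left hy.le] using (hasDerivAt_const y (0 : ℝ)).congr_of_eventuallyEq this
    · have : (fun s : ℝ => max 0 s ^ (k + 2)) =ᶠ[nhds y] fun s => s ^ (k + 2) := by
        filter_upwards [Ioi_mem_nhds hy] with z hz
        simp [max_eq_right (Set.mem_Ioi.1 hz).le]
      simpa [max_eq_right hy.le] using (hasDerivAt_pow (k + 2) y).congr_of_eventuallyEq this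
  · fun_prop
  · fun_prop

/-- The radial weight `(1 - |y|²)₊ ^ k`, supported in the unit ball. -/
noncomputable def ballWeight {n : ℕ} (k : ℕ) (y : EuclideanSpace ℝ (Fin n)) : ℝ :=
  max 0 (1 - ‖y‖ ^ 2) ^ k

section BallWeight

variable {n : ℕ}

lemma ballWeight_nonneg (k : ℕ) (y : EuclideanSpace ℝ (Fin n)) : 0 ≤ ballWeight k y :=
  pow_nonneg (le_max_left _ _) _

lemma continuous_ballWeight (k : ℕ) :
    Continuous (ballWeight k : EuclideanSpace ℝ (Fin n) → ℝ) := by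
  unfold ballWeight
  fun_prop

lemma ballWeight_eq_zero (k : ℕ) {y : EuclideanSpace ℝ (Fin n)} (hy : 1 ≤ ‖y‖) :
    ballWeight (k + 1) y = 0 := by
  have : 1 - ‖y‖ ^ 2 ≤ 0 := by nlinarith
  simp [ballWeight, max_eq_left this]

lemma hasCompactSupport_ballWeight (k : ℕ) :
    HasCompactSupport (ballWeight (k + 1) : EuclideanSpace ℝ (Fin n) → ℝ) := by
  refine HasCompactSupport.intro (isCompact_closedBall 0 1) fun y hy => ballWeight_eq_zero k ?_
  simp only [Metric.mem_closedBall, dist_zero_right, not_le] at hy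
  exact hy.le

lemma integral_ballWeight_pos (k : ℕ) :
    0 < ∫ y : EuclideanSpace ℝ (Fin n), ballWeight (k + 1) y :=
  (continuous_ballWeight _).integral_pos_of_hasCompactSupport_nonneg_nonzero (x := 0)
    (hasCompactSupport_ballWeight k) (ballWeight_nonneg _) (by simp [ballWeight])

lemma hasFDerivAt_ballWeight (k : ℕ) (y : EuclideanSpace ℝ (Fin n)) :
    HasFDerivAt (ballWeight (k + 2))
      (((k + 2 : ℝ) * max 0 (1 - ‖y‖ ^ 2) ^ (k + 1)) •
        (-((2 : ℝ) • innerSL ℝ y) : EuclideanSpace ℝ (Fin n) →L[ℝ] ℝ)) y :=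
  (hasDerivAt_max_zero_pow k _).comp_hasFDerivAt (f := fun y => 1 - ‖y‖ ^ 2) y
    (by simpa [two_smul] using (hasStrictFDerivAt_norm_sq y).hasFDerivAt.const_sub 1)

lemma differentiable_ballWeight (k : ℕ) :
    Differentiable ℝ (ballWeight (k + 2) : EuclideanSpace ℝ (Fin n) → ℝ) :=
  fun y => (hasFDerivAt_ballWeight k y).differentiableAt

lemma partialDeriv_ballWeight (k : ℕ) (i : Fin n) :
    partialDeriv i (ballWeight (k + 2)) =
      fun y => -(2 * (k + 2)) * (y i * ballWeight (k + 1) y) := by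
  ext y
  rw [partialDeriv, (hasFDerivAt_ballWeight k y).fderiv]
  simp [ballWeight, EuclideanSpace.inner_single_right]
  ring

lemma continuous_partialDeriv_ballWeight (k : ℕ) (i : Fin n) :
    Continuous (partialDeriv i (ballWeight (k + 2))) := by
  rw [partialDeriv_ballWeight]
  have := continuous_ballWeight (n := n) (k + 1)
  fun_prop

lemma hasCompactSupport_partialDeriv_ballWeight (k : ℕ) (i : Fin n) :
    HasCompactSupport (partialDeriv i (ballWeight (k + 2))) := by
  rw [partialDeriv_ballWeight]
  exact ((hasCompactSupport_ballWeight k).mul_left).mul_left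

end BallWeight

section MeanValue

variable {n : ℕ} {u : EuclideanSpace ℝ (Fin n) → ℝ}

lemma integral_mul_partialDeriv_ballWeight (hu : ContDiff ℝ ∞ u) (k : ℕ) (i : Fin n)
    (x : EuclideanSpace ℝ (Fin n)) (r : ℝ) :
    ∫ y, u (x + r • y) * partialDeriv i (ballWeight (k + 2)) y =
      -(r * ∫ y, partialDeriv i u (x + r • y) * ballWeight (k + 2) y) := by
  have hd : Differentiable ℝ u := hu.differentiable (by simp)
  have hc := hu.continuous
  have hc' := (hu.partialDeriv i).continuous
  have hfd (y : EuclideanSpace ℝ (Fin n)) :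
      fderiv ℝ (fun y => u (x + r • y)) y (EuclideanSpace.single i 1) =
        r * partialDeriv i u (x + r • y) := by
    have h : HasFDerivAt (fun y => u (x + r • y)) ((fderiv ℝ u (x + r • y)).comp
        (r • ContinuousLinearMap.id ℝ (EuclideanSpace ℝ (Fin n)))) y :=
      (hd _).hasFDerivAt.comp y (((hasFDerivAt_id y).const_smul r).const_add x)
    simp [h.fderiv, partialDeriv]
  rw [← integral_const_mul]
  have := integral_mul_fderiv_eq_neg_fderiv_mul_of_integrable (μ := volume)
    (f := fun y => u (x + r • y)) (g := ballWeight (k + 2)) (v := EuclideanSpace.single i 1)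
    ?_ ?_ ?_ (fun y _ => by fun_prop) (fun y _ => differentiable_ballWeight k y)
  · simpa only [hfd, mul_assoc, partialDeriv] using this
  · simp only [hfd]
    exact Continuous.integrable_of_hasCompactSupport
      (by have := continuous_ballWeight (n := n) (k + 2); fun_prop)
      (hasCompactSupport_ballWeight _).mul_left
  · exact Continuous.integrable_of_hasCompactSupport
      ((by fun_prop : Continuous fun y => u (x + r • y)).mul
        (continuous_partialDeriv_ballWeight k i))
      (hasCompactSupport_partialDeriv_ballWeight k i).mul_left
  · exact Continuous.integrable_of_hasCompactSupport
      (by have := continuous_ballWeight (n := n) (k + 2); fun_prop)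
      (hasCompactSupport_ballWeight _).mul_left

lemma integral_fderiv_mul_ballWeight (hu : ContDiff ℝ ∞ u) (k : ℕ)
    (x : EuclideanSpace ℝ (Fin n)) (r : ℝ) :
    ∫ y, fderiv ℝ u (x + r • y) y * ballWeight (k + 1) y =
      r / (2 * (k + 2)) * ∫ y, lap u (x + r • y) * ballWeight (k + 2) y := by
  have hk : (0 : ℝ) < 2 * (k + 2) := by positivity
  have h1 (y : EuclideanSpace ℝ (Fin n)) : fderiv ℝ u (x + r • y) y * ballWeight (k + 1) y =
      ∑ i, -(2 * (k + 2) : ℝ)⁻¹ *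
        (partialDeriv i u (x + r • y) * partialDeriv i (ballWeight (k + 2)) y) := by
    rw [fderiv_apply_eq_sum_partialDeriv, Finset.sum_mul]
    refine Finset.sum_congr rfl fun i _ => ?_
    rw [partialDeriv_ballWeight]
    field_simp
  have h2 (y : EuclideanSpace ℝ (Fin n)) : lap u (x + r • y) * ballWeight (k + 2) y =
      ∑ i, partialDeriv i (partialDeriv i u) (x + r • y) * ballWeight (k + 2) y := by
    rw [lap_eq_sum_partialDeriv, Finset.sum_mul]
  simp only [h1, h2]
  rw [integral_finsetSum, integral_finsetSum, Finset.mul_sum]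
  · refine Finset.sum_congr rfl fun i _ => ?_
    rw [integral_const_mul, integral_mul_partialDeriv_ballWeight (hu.partialDeriv i)]
    field_simp
  · intro i _
    have := ((hu.partialDeriv i).partialDeriv i).continuous
    exact Continuous.integrable_of_hasCompactSupport
      (by have := continuous_ballWeight (n := n) (k + 2); fun_prop)
      (hasCompactSupport_ballWeight _).mul_left
  · intro i _
    have := (hu.partialDeriv i).continuous
    exact (Continuous.integrable_of_hasCompactSupport
      ((by fun_prop : Continuous fun y => partialDeriv i u (x + r • y)).mul
        (continuous_partialDeriv_ballWeight k i))
      (hasCompactSupport_partialDeriv_ballWeight k i).mul_left).const_mul _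

lemma hasDerivAt_integral_mul_ballWeight (hu : ContDiff ℝ ∞ u) (k : ℕ)
    (x : EuclideanSpace ℝ (Fin n)) (r : ℝ) :
    HasDerivAt (fun r : ℝ => ∫ y, u (x + r • y) * ballWeight (k + 1) y)
      (r / (2 * (k + 2)) * ∫ y, lap u (x + r • y) * ballWeight (k + 2) y) r := by
  rw [← integral_fderiv_mul_ballWeight hu]
  have hc := hu.continuous
  have hd : Differentiable ℝ u := hu.differentiable (by simp)
  have hf : Continuous (fderiv ℝ u) := hu.continuous_fderiv (by simp)
  have hw := continuous_ballWeight (n := n) (k + 1)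
  have hG : Continuous fun p : ℝ × EuclideanSpace ℝ (Fin n) =>
      fderiv ℝ u (x + p.1 • p.2) p.2 * ballWeight (k + 1) p.2 := by fun_prop
  obtain ⟨B, hB⟩ := ((isCompact_closedBall r 1).prod
    (isCompact_closedBall (0 : EuclideanSpace ℝ (Fin n)) 1)).exists_bound_of_continuousOn
    hG.continuousOn
  refine (hasDerivAt_integral_of_dominated_loc_of_deriv_le
    (F := fun (r : ℝ) y => u (x + r • y) * ballWeight (k + 1) y)
    (F' := fun (r : ℝ) y => fderiv ℝ u (x + r • y) y * ballWeight (k + 1) y)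
    (bound := (Metric.closedBall (0 : EuclideanSpace ℝ (Fin n)) 1).indicator fun _ => B)
    (Metric.closedBall_mem_nhds r one_pos) (.of_forall fun t => ?_) ?_ ?_
    (.of_forall fun y t ht => ?_) ?_ (.of_forall fun y t _ => ?_)).2
  · exact Continuous.aestronglyMeasurable (by fun_prop)
  · exact Continuous.integrable_of_hasCompactSupport (by fun_prop)
      (hasCompactSupport_ballWeight _).mul_left
  · exact Continuous.aestronglyMeasurable (by fun_prop)
  · by_cases hy : y ∈ Metric.closedBall (0 : EuclideanSpace ℝ (Fin n)) 1
    · rw [Set.indicator_of_mem hy]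
      exact hB (t, y) ⟨ht, hy⟩
    · rw [Set.indicator_of_notMem hy, ballWeight_eq_zero]
      · simp
      · simp only [Metric.mem_closedBall, dist_zero_right, not_le] at hy
        exact hy.le
  · exact (integrable_indicator_iff Metric.isClosed_closedBall.measurableSet).2
      (integrableOn_const (isCompact_closedBall _ _).measure_lt_top.ne)
  · have h : HasDerivAt (fun t : ℝ => x + t • y) y t := by
      simpa using ((hasDerivAt_id t).smul_const y).const_add x
    exact ((hd _).hasFDerivAt.comp_hasDerivAt t h).mul_const _

lemma integral_mul_ballWeight_of_lap_eq_zero (hu : ContDiff ℝ ∞ u) (h : ∀ x, lap u x = 0)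
    (k : ℕ) (x : EuclideanSpace ℝ (Fin n)) (r : ℝ) :
    ∫ y, u (x + r • y) * ballWeight (k + 1) y =
      u x * ∫ y : EuclideanSpace ℝ (Fin n), ballWeight (k + 1) y := by
  have hD := hasDerivAt_integral_mul_ballWeight hu k x
  have := is_const_of_deriv_eq_zero (fun r => (hD r).differentiableAt)
    (fun r => by simp [(hD r).deriv, h]) r 0
  simpa [integral_const_mul] using this

lemma integral_mul_ballWeight_of_lap_lap_eq_zero (hu : ContDiff ℝ ∞ u)
    (h : ∀ x, lap (lap u) x = 0) (k : ℕ) (x : EuclideanSpace ℝ (Fin n)) (r : ℝ) :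
    ∫ y, u (x + r • y) * ballWeight (k + 1) y =
      u x * (∫ y : EuclideanSpace ℝ (Fin n), ballWeight (k + 1) y) +
        r ^ 2 / (4 * (k + 2)) *
          (lap u x * ∫ y : EuclideanSpace ℝ (Fin n), ballWeight (k + 2) y) := by
  set c := lap u x * ∫ y : EuclideanSpace ℝ (Fin n), ballWeight (k + 2) y with hc
  have hk : (0 : ℝ) < k + 2 := by positivity
  have hD (r : ℝ) : HasDerivAt (fun r : ℝ => (∫ y, u (x + r • y) * ballWeight (k + 1) y) -
      r ^ 2 / (4 * (k + 2)) * c) 0 r := by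
    have h1 := hasDerivAt_integral_mul_ballWeight hu k x r
    rw [integral_mul_ballWeight_of_lap_eq_zero hu.lap h (k + 1)] at h1
    refine (h1.sub (((hasDerivAt_pow 2 r).div_const (4 * (k + 2 : ℝ))).mul_const c)).congr_deriv ?_
    rw [← hc]
    field_simp
    push_cast
    ring
  have := is_const_of_deriv_eq_zero (fun r => (hD r).differentiableAt)
    (fun r => (hD r).deriv) r 0
  simp only [zero_smul, add_zero, integral_const_mul] at this
  linear_combination this

end MeanValue

section Estimates

variable {n : ℕ}

lemma abs_integral_mul_le_of_bound {u g : EuclideanSpace ℝ (Fin n) → ℝ} (hg : Continuous g)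
    (hg' : ∀ y, 1 < ‖y‖ → g y = 0) {x : EuclideanSpace ℝ (Fin n)} {r M : ℝ} (hr : 0 ≤ r)
    (hM : ∀ z ∈ Metric.closedBall x r, |u z| ≤ M) :
    |∫ y, u (x + r • y) * g y| ≤ M * ∫ y, |g y| := by
  have hs : HasCompactSupport g := .intro (isCompact_closedBall 0 1) fun y hy => hg' y (by
    simpa using hy)
  rw [← integral_const_mul, ← Real.norm_eq_abs]
  refine norm_integral_le_of_norm_le ((hg.integrable_of_hasCompactSupport hs).abs.const_mul M)
    (.of_forall fun y => ?_)
  rw [Real.norm_eq_abs, abs_mul]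
  by_cases hy : 1 < ‖y‖
  · simp [hg' y hy]
  · refine mul_le_mul_of_nonneg_right (hM _ ?_) (abs_nonneg _)
    simp only [Metric.mem_closedBall, dist_self_add_left, norm_smul, Real.norm_eq_abs,
      abs_of_nonneg hr]
    nlinarith

lemma exists_abs_partialDeriv_le (n : ℕ) : ∃ K : ℝ, 0 ≤ K ∧
    ∀ u : EuclideanSpace ℝ (Fin n) → ℝ, ContDiff ℝ ∞ u → (∀ x, lap (lap u) x = 0) →
      ∀ (i : Fin n) (R M : ℝ), 0 < R → (∀ x, ‖x‖ ≤ 2 * R → |u x| ≤ M) →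
        ∀ x, ‖x‖ ≤ R → |partialDeriv i u x| ≤ K / R * M := by
  set W := ∫ y : EuclideanSpace ℝ (Fin n), ballWeight 2 y
  have hWpos : 0 < W := integral_ballWeight_pos 1
  set A : Fin n → ℝ := fun i => ∫ y, |partialDeriv i (ballWeight 2) y|
  have hA0 (i : Fin n) : 0 ≤ A i := integral_nonneg fun y => abs_nonneg _
  have hAsum : 0 ≤ ∑ i, A i := Finset.sum_nonneg fun i _ => hA0 i
  refine ⟨3 * (∑ i, A i) / W, by positivity, fun u hu h i R M hR hM x hx => ?_⟩
  have hM0 : 0 ≤ M := (abs_nonneg _).trans (hM 0 (by simp [hR.le]))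
  have hb (r : ℝ) (hr : 0 ≤ r) (hrR : r ≤ R) :
      |∫ y, u (x + r • y) * partialDeriv i (ballWeight 2) y| ≤ M * A i := by
    refine abs_integral_mul_le_of_bound (continuous_partialDeriv_ballWeight 0 i)
      (fun y hy => ?_) hr fun z hz => hM z ?_
    · simp [partialDeriv_ballWeight 0, ballWeight_eq_zero 0 hy.le]
    · rw [Metric.mem_closedBall, dist_eq_norm] at hz
      linarith [norm_le_norm_add_norm_sub' z x]
  have hu' := hu.partialDeriv i
  have h' := lap_lap_partialDeriv hu h i
  have m1 := integral_mul_ballWeight_of_lap_lap_eq_zero hu' h' 1 x (R / 2)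
  have m2 := integral_mul_ballWeight_of_lap_lap_eq_zero hu' h' 1 x R
  have i1 := integral_mul_partialDeriv_ballWeight hu 0 i x (R / 2)
  have i2 := integral_mul_partialDeriv_ballWeight hu 0 i x R
  have b1 := hb (R / 2) (by linarith) (by linarith)
  have b2 := hb R hR.le le_rfl
  norm_num at m1 m2 i1 i2
  rw [i1, m1] at b1
  rw [i2, m2] at b2
  have hAi : A i ≤ ∑ i, A i := Finset.single_le_sum (fun i _ => hA0 i) (Finset.mem_univ i)
  have key : |3 * (R * (partialDeriv i u x * W))| ≤ 9 * (M * A i) := by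
    rw [abs_le] at b1 b2 ⊢
    constructor <;> nlinarith [b1.1, b1.2, b2.1, b2.2]
  have e : |3 * (R * (partialDeriv i u x * W))| = 3 * (R * (|partialDeriv i u x| * W)) := by
    simp [abs_mul, abs_of_pos hR, abs_of_pos hWpos]
  rw [e] at key
  have : |partialDeriv i u x| * (R * W) ≤ 3 * (∑ i, A i) * M := by nlinarith
  calc |partialDeriv i u x| ≤ 3 * (∑ i, A i) * M / (R * W) := by
        rwa [le_div_iff₀ (by positivity)]
    _ = _ := by field_simp

/-- The iterated partial derivative of `u` along the coordinates listed in `l`. -/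
noncomputable def iteratedPartialDeriv (l : List (Fin n)) (u : EuclideanSpace ℝ (Fin n) → ℝ) :
    EuclideanSpace ℝ (Fin n) → ℝ :=
  l.foldl (fun v i => partialDeriv i v) u

lemma exists_abs_iteratedPartialDeriv_le (n k : ℕ) : ∃ K : ℝ, 0 ≤ K ∧
    ∀ u : EuclideanSpace ℝ (Fin n) → ℝ, ContDiff ℝ ∞ u → (∀ x, lap (lap u) x = 0) →
      ∀ l : List (Fin n), l.length = k → ∀ R M : ℝ, 0 < R →
        (∀ x, ‖x‖ ≤ 2 ^ k * R → |u x| ≤ M) →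
        ∀ x, ‖x‖ ≤ R → |iteratedPartialDeriv l u x| ≤ K / R ^ k * M := by
  induction k with
  | zero =>
    refine ⟨1, zero_le_one, fun u _ _ l hl R M _ hM x hx => ?_⟩
    obtain rfl := List.length_eq_zero_iff.1 hl
    simpa [iteratedPartialDeriv] using hM x (by simpa using hx)
  | succ k ih =>
    obtain ⟨K, hK, ih⟩ := ih
    obtain ⟨K', hK', hstep⟩ := exists_abs_partialDeriv_le n
    refine ⟨K * K', by positivity, fun u hu h l hl R M hR hM x hx => ?_⟩
    obtain ⟨i, l, rfl⟩ := List.exists_cons_of_length_eq_add_one hl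
    have hM0 : 0 ≤ M := (abs_nonneg _).trans (hM 0 (by simp; positivity))
    have h2 : (1 : ℝ) ≤ 2 ^ k := one_le_pow₀ one_le_two
    have hb : ∀ x, ‖x‖ ≤ 2 ^ k * R → |partialDeriv i u x| ≤ K' / R * M := fun x hx =>
      (hstep u hu h i (2 ^ k * R) M (by positivity)
        (fun x hx => hM x (by rw [pow_succ]; linarith)) x hx).trans (by
          gcongr
          nlinarith)
    refine (ih _ (hu.partialDeriv i) (lap_lap_partialDeriv hu h i) l (by simpa using hl) R _ hR hb
      x hx).trans_eq ?_
    field_simp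
    ring

end Estimates

section Polynomial

open MvPolynomial

variable {n : ℕ}

lemma exists_radial_primitive (p : MvPolynomial (Fin n) ℝ) :
    ∃ q : MvPolynomial (Fin n) ℝ, q.totalDegree ≤ p.totalDegree ∧ ∀ (x : Fin n → ℝ) (t : ℝ),
      HasDerivAt (fun t : ℝ => t * eval (t • x) q) (eval (t • x) p) t := by
  refine ⟨∑ s ∈ p.support, monomial s (coeff s p / (s.degree + 1)), ?_, fun x t => ?_⟩
  · refine totalDegree_finsetSum_le fun s hs => (totalDegree_monomial_le _ _).trans ?_
    exact le_totalDegree hs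
  · have hmon (s : Fin n →₀ ℕ) (c t : ℝ) :
        eval (t • x) (monomial s c) = t ^ s.degree * (c * s.prod fun i e => x i ^ e) := by
      rw [eval_monomial, Finsupp.degree_apply]
      simp only [Finsupp.prod, Pi.smul_apply, smul_eq_mul, mul_pow, Finset.prod_mul_distrib,
        Finset.prod_pow_eq_pow_sum]
      ring
    conv => enter [2]; rw [p.as_sum]
    simp only [map_sum, hmon, Finset.mul_sum]
    refine HasDerivAt.fun_sum fun s _ => ?_
    have h := (hasDerivAt_pow (s.degree + 1) t).mul_const
      (coeff s p / (s.degree + 1) * s.prod fun i e => x i ^ e)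
    have e : (fun t : ℝ => t * (t ^ s.degree *
        (coeff s p / (s.degree + 1) * s.prod fun i e => x i ^ e))) =
        fun t => t ^ (s.degree + 1) * (coeff s p / (s.degree + 1) * s.prod fun i e => x i ^ e) := by
      ext t
      ring
    rw [e]
    refine h.congr_deriv ?_
    rw [Nat.add_sub_cancel]
    push_cast
    field_simp

lemma exists_eval_eq_of_partialDeriv {u : EuclideanSpace ℝ (Fin n) → ℝ} (hu : Differentiable ℝ u)
    {k : ℕ} (h : ∀ i, ∃ p : MvPolynomial (Fin n) ℝ, p.totalDegree ≤ k ∧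
      ∀ x, partialDeriv i u x = eval (fun j => x j) p) :
    ∃ p : MvPolynomial (Fin n) ℝ, p.totalDegree ≤ k + 1 ∧
      ∀ x, u x = eval (fun j => x j) p := by
  choose p hpdeg hp using h
  choose q hqdeg hq using fun i => exists_radial_primitive (p i)
  refine ⟨C (u 0) + ∑ i, X i * q i, ?_, fun x => ?_⟩
  · refine (totalDegree_add _ _).trans (max_le (by simp) ?_)
    refine totalDegree_finsetSum_le fun i _ => (totalDegree_mul _ _).trans ?_
    have := (hqdeg i).trans (hpdeg i)
    simp only [totalDegree_X]
    omega
  · have hD (t : ℝ) : HasDerivAt (fun t : ℝ => u (t • x) -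
        ∑ i, x i * (t * eval (t • fun j => x j) (q i))) 0 t := by
      have h1 : HasDerivAt (fun t : ℝ => t • x) x t := by
        simpa using (hasDerivAt_id t).smul_const x
      refine (((hu _).hasFDerivAt.comp_hasDerivAt t h1).sub
        (HasDerivAt.fun_sum fun i (_ : i ∈ Finset.univ) =>
          (hq i (fun j => x j) t).const_mul (x i))).congr_deriv ?_
      rw [fderiv_apply_eq_sum_partialDeriv, sub_eq_zero]
      refine Finset.sum_congr rfl fun i _ => ?_
      rw [hp]
      rfl
    have := is_const_of_deriv_eq_zero (fun t => (hD t).differentiableAt)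
      (fun t => (hD t).deriv) 1 0
    simp only [one_smul, zero_smul, one_mul, zero_mul, mul_zero, Finset.sum_const_zero,
      sub_zero] at this
    simp only [map_add, map_sum, map_mul, eval_C, eval_X]
    linarith

lemma exists_eval_eq_of_iteratedPartialDeriv_eq_zero (k : ℕ) :
    ∀ u : EuclideanSpace ℝ (Fin n) → ℝ, ContDiff ℝ ∞ u →
      (∀ l : List (Fin n), l.length = k + 1 → ∀ x, iteratedPartialDeriv l u x = 0) →
      ∃ p : MvPolynomial (Fin n) ℝ, p.totalDegree ≤ k ∧ ∀ x, u x = eval (fun j => x j) p := by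
  induction k with
  | zero =>
    intro u hu h
    refine ⟨C (u 0), by simp, fun x => ?_⟩
    have hd : Differentiable ℝ u := hu.differentiable (by simp)
    rw [eval_C]
    refine is_const_of_fderiv_eq_zero hd (fun x => ?_) x 0
    ext y
    rw [fderiv_apply_eq_sum_partialDeriv]
    exact Finset.sum_eq_zero fun i _ => by
      rw [show partialDeriv i u x = 0 from h [i] rfl x, mul_zero]
  | succ k ih =>
    intro u hu h
    exact exists_eval_eq_of_partialDeriv (hu.differentiable (by simp)) fun i =>
      ih _ (hu.partialDeriv i) fun l hl => h (i :: l) (by simp [hl])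

end Polynomial

/-- A biharmonic function on ℝⁿ with polynomial growth of rate d ≥ 0 is a polynomial of
degree at most ⌊d⌋. -/
theorem biharmonic_poly_growth_is_polynomial {n : ℕ} (u : EuclideanSpace ℝ (Fin n) → ℝ)
    (hu : ContDiff ℝ (⊤ : ℕ∞) u) (hbih : ∀ x, lap (lap u) x = 0)
    (d : ℝ) (hd : 0 ≤ d) (C : ℝ) (hC : 0 < C)
    (hgrow : ∀ x, |u x| ≤ C * (1 + ‖x‖ ^ d)) :
    ∃ p : MvPolynomial (Fin n) ℝ, p.totalDegree ≤ ⌊d⌋₊ ∧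
      ∀ x, u x = MvPolynomial.eval (fun i => x i) p := by
  refine exists_eval_eq_of_iteratedPartialDeriv_eq_zero _ u hu fun l hl x => ?_
  set k := ⌊d⌋₊ + 1 with hk
  obtain ⟨K, hK, hest⟩ := exists_abs_iteratedPartialDeriv_le n k
  have hdk : d < k := by simpa [hk] using Nat.lt_floor_add_one d
  have hbound : ∀ R : ℝ, max 1 ‖x‖ ≤ R → |iteratedPartialDeriv l u x| ≤
      K * (C * (1 + (2 ^ k) ^ d)) * R ^ (-(k - d)) := by
    intro R hR
    have hR1 : 1 ≤ R := (le_max_left _ _).trans hR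
    have hR0 : 0 < R := by linarith
    refine (hest u hu hbih l hl R (C * (1 + (2 ^ k * R) ^ d)) hR0 (fun y hy => ?_) x
      ((le_max_right _ _).trans hR)).trans ?_
    · refine (hgrow y).trans ?_
      gcongr
    · have h1 : (1 : ℝ) ≤ R ^ d := Real.one_le_rpow hR1 hd
      rw [Real.mul_rpow (by positivity) hR0.le, neg_sub, Real.rpow_sub hR0, Real.rpow_natCast]
      calc K / R ^ k * (C * (1 + (2 ^ k) ^ d * R ^ d))
          ≤ K / R ^ k * (C * (R ^ d + (2 ^ k) ^ d * R ^ d)) := by gcongr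
        _ = _ := by ring
  have hlim := (tendsto_rpow_neg_atTop (sub_pos.2 hdk)).const_mul (K * (C * (1 + (2 ^ k) ^ d)))
  rw [mul_zero] at hlim
  refine abs_nonpos_iff.1 (ge_of_tendsto hlim ?_)
  filter_upwards [Filter.eventually_ge_atTop (max 1 ‖x‖)] with R hR using hbound R hR
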